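/- Let e₁,…,e₅ be the standard basis of ℂ⁵ and define the alternating bilinear forms ω₁(x,y) = x₁y₃ − x₃y₁ + x₂y₄ − x₄y₂ and ω₂(x,y) = x₁y₄ − x₄y₁ + x₂y₅ − x₅y₂ on ℂ⁵. For every (s,t) ∈ ℂ² with (s,t) ≠ (0,0), the radical {v ∈ ℂ⁵ : (sω₁ + tω₂)(v,w) = 0 for all w} of the form sω₁ + tω₂ equals the one-dimensional span of t²e₃ − s t e₄ + s²e₅. In particular every nonzero form in the pencil spanned by ω₁ and ω₂ has rank exactly 4. -/

import Mathlib

/-- The alternating form `ω₁ = e₁*∧e₃* + e₂*∧e₄*` on `ℂ⁵` (0-indexed coordinates). -/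
noncomputable def omega1 : (Fin 5 → ℂ) → (Fin 5 → ℂ) → ℂ := fun x y =>
  x 0 * y 2 - x 2 * y 0 + x 1 * y 3 - x 3 * y 1

/-- The alternating form `ω₂ = e₁*∧e₄* + e₂*∧e₅*` on `ℂ⁵` (0-indexed coordinates). -/
noncomputable def omega2 : (Fin 5 → ℂ) → (Fin 5 → ℂ) → ℂ := fun x y =>
  x 0 * y 3 - x 3 * y 0 + x 1 * y 4 - x 4 * y 1

/-- The radical of any nonzero member `sω₁ + tω₂` of the pencil is the line spanned by
`t²e₃ − st e₄ + s²e₅`; in particular every nonzero form of the pencil has rank four. -/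
theorem pencil_radical (s t : ℂ) (hst : (s, t) ≠ (0, 0)) :
    {v : Fin 5 → ℂ | ∀ w, s * omega1 v w + t * omega2 v w = 0} =
      ↑(Submodule.span ℂ ({![0, 0, t ^ 2, -(s * t), s ^ 2]} : Set (Fin 5 → ℂ))) ∧
    (![0, 0, t ^ 2, -(s * t), s ^ 2] : Fin 5 → ℂ) ≠ 0 := by
  have hst' : s ≠ 0 ∨ t ≠ 0 := by
    by_contra! h
    exact hst (by rw [h.1, h.2])
  refine ⟨?_, ?_⟩
  · ext v
    simp only [Set.mem_setOf_eq, SetLike.mem_coe, Submodule.mem_span_singleton]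
    constructor
    · intro h
      have h0 : s * v 2 + t * v 3 = 0 := by
        have := h ![1, 0, 0, 0, 0]
        simp [omega1, omega2] at this
        linear_combination -this
      have h1 : s * v 3 + t * v 4 = 0 := by
        have := h ![0, 1, 0, 0, 0]
        simp [omega1, omega2] at this
        linear_combination -this
      have h2 : s * v 0 = 0 := by
        have := h ![0, 0, 1, 0, 0]
        simpa [omega1, omega2] using this
      have h3 : s * v 1 + t * v 0 = 0 := by
        have := h ![0, 0, 0, 1, 0]
        simpa [omega1, omega2] using this
      have h4 : t * v 1 = 0 := by
        have := h ![0, 0, 0, 0, 1]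
        simpa [omega1, omega2] using this
      rcases hst' with hs | ht
      · have v0 : v 0 = 0 := by simpa [hs] using h2
        have v1 : v 1 = 0 := by simpa [hs, v0] using h3
        refine ⟨v 4 / s ^ 2, ?_⟩
        have e3 : v 3 = -(t * v 4) / s := by
          field_simp
          linear_combination h1
        have e2 : v 2 = -(t * v 3) / s := by
          field_simp
          linear_combination h0
        ext i
        fin_cases i
        · simp [v0]
        · simp [v1]
        · simp [e2, e3]
          field_simp
        · simp [e3]
          field_simp
        · simp [hs]
      · have v1 : v 1 = 0 := by simpa [ht] using h4
        have v0 : v 0 = 0 := by simpa [ht, v1] using h3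
        refine ⟨v 2 / t ^ 2, ?_⟩
        have e3 : v 3 = -(s * v 2) / t := by
          field_simp
          linear_combination h0
        have e4 : v 4 = -(s * v 3) / t := by
          field_simp
          linear_combination h1
        ext i
        fin_cases i
        · simp [v0]
        · simp [v1]
        · simp [ht]
        · simp [e3]
          field_simp
        · simp [e4, e3]
          field_simp
    · rintro ⟨a, rfl⟩ w
      simp [omega1, omega2]
      ring
  · intro h
    have a2 := congrFun h 2
    have a4 := congrFun h 4
    simp at a2 a4
    rcases hst' with hs | ht
    · exact hs a4
    · exact ht a2
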